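/- The expected consumer surplus E is a convex function of the price vector p on ℝ^n. -/

import Mathlib

open Finset

/-- Sum of exponentiated utilities within group `j`. -/
noncomputable def groupSum {n m : ℕ} (grp : Fin n → Fin m) (a : Fin n → ℝ) (μ : Fin m → ℝ)
    (p : EuclideanSpace ℝ (Fin n)) (j : Fin m) : ℝ :=
  ∑ k ∈ Finset.univ.filter (fun k => grp k = j), Real.exp ((a k - p k) / μ j)

/-- The nested-logit partition function. -/
noncomputable def partitionFun {n m : ℕ} (grp : Fin n → Fin m) (a : Fin n → ℝ) (μ : Fin m → ℝ)
    (p : EuclideanSpace ℝ (Fin n)) : ℝ :=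
  ∑ h : Fin m, (groupSum grp a μ p h) ^ (μ h)

/-- The expected consumer surplus `E(p)`. -/
noncomputable def surplus {n m : ℕ} (grp : Fin n → Fin m) (a : Fin n → ℝ) (μ : Fin m → ℝ)
    (p : EuclideanSpace ℝ (Fin n)) : ℝ :=
  Real.log (partitionFun grp a μ p)

/-- Hölder's inequality in weighted geometric-mean form. -/
theorem sum_rpow_mul_rpow_le {ι : Type*} (S : Finset ι) {f g : ι → ℝ}
    (hf : ∀ i ∈ S, 0 ≤ f i) (hg : ∀ i ∈ S, 0 ≤ g i) {s t : ℝ} (hs : 0 < s) (ht : 0 < t)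
    (hst : s + t = 1) :
    ∑ i ∈ S, f i ^ s * g i ^ t ≤ (∑ i ∈ S, f i) ^ s * (∑ i ∈ S, g i) ^ t := by
  have hpq : Real.HolderConjugate (1 / s) (1 / t) := by
    simpa using Real.HolderConjugate.inv_inv hs ht hst
  refine (Real.inner_le_Lp_mul_Lq_of_nonneg S hpq
    (fun i hi => Real.rpow_nonneg (hf i hi) s)
    (fun i hi => Real.rpow_nonneg (hg i hi) t)).trans_eq ?_
  rw [one_div_one_div, one_div_one_div]
  congr 2
  · refine Finset.sum_congr rfl fun i hi => ?_
    rw [one_div, Real.rpow_rpow_inv (hf i hi) hs.ne']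
  · refine Finset.sum_congr rfl fun i hi => ?_
    rw [one_div, Real.rpow_rpow_inv (hg i hi) ht.ne']

theorem groupSum_nonneg {n m : ℕ} (grp : Fin n → Fin m) (a : Fin n → ℝ) (μ : Fin m → ℝ)
    (p : EuclideanSpace ℝ (Fin n)) (j : Fin m) : 0 ≤ groupSum grp a μ p j :=
  Finset.sum_nonneg fun _ _ => (Real.exp_pos _).le

theorem groupSum_pos {n m : ℕ} {grp : Fin n → Fin m} (hgrp : Function.Surjective grp)
    (a : Fin n → ℝ) (μ : Fin m → ℝ) (p : EuclideanSpace ℝ (Fin n)) (j : Fin m) :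
    0 < groupSum grp a μ p j := by
  obtain ⟨k, hk⟩ := hgrp j
  exact Finset.sum_pos (fun _ _ => Real.exp_pos _) ⟨k, by simp [hk]⟩

theorem partitionFun_pos {n m : ℕ} [Nonempty (Fin m)] {grp : Fin n → Fin m}
    (hgrp : Function.Surjective grp) (a : Fin n → ℝ) (μ : Fin m → ℝ)
    (p : EuclideanSpace ℝ (Fin n)) : 0 < partitionFun grp a μ p :=
  Finset.sum_pos (fun j _ => Real.rpow_pos_of_pos (groupSum_pos hgrp a μ p j) _)
    Finset.univ_nonempty

/-- Each group sum is log-convex in the price vector. -/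
theorem groupSum_combo_le {n m : ℕ} (grp : Fin n → Fin m) (a : Fin n → ℝ) (μ : Fin m → ℝ)
    (p q : EuclideanSpace ℝ (Fin n)) (j : Fin m) {s t : ℝ} (hs : 0 < s) (ht : 0 < t)
    (hst : s + t = 1) :
    groupSum grp a μ (s • p + t • q) j ≤ groupSum grp a μ p j ^ s * groupSum grp a μ q j ^ t := by
  refine le_trans (le_of_eq ?_) (sum_rpow_mul_rpow_le _ (fun _ _ => (Real.exp_pos _).le)
    (fun _ _ => (Real.exp_pos _).le) hs ht hst)
  refine Finset.sum_congr rfl fun k _ => ?_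
  rw [← Real.exp_mul, ← Real.exp_mul, ← Real.exp_add]
  congr 1
  obtain rfl : t = 1 - s := by linarith
  simp only [PiLp.add_apply, PiLp.smul_apply, smul_eq_mul]
  ring

/-- The partition function is log-convex in the price vector. -/
theorem partitionFun_combo_le {n m : ℕ} (grp : Fin n → Fin m) (a : Fin n → ℝ) (μ : Fin m → ℝ)
    (hμ0 : ∀ j, 0 < μ j) (p q : EuclideanSpace ℝ (Fin n)) {s t : ℝ} (hs : 0 < s) (ht : 0 < t)
    (hst : s + t = 1) :
    partitionFun grp a μ (s • p + t • q) ≤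
      partitionFun grp a μ p ^ s * partitionFun grp a μ q ^ t := by
  refine le_trans (Finset.sum_le_sum fun j _ => ?_) (sum_rpow_mul_rpow_le _
    (fun j _ => Real.rpow_nonneg (groupSum_nonneg grp a μ p j) (μ j))
    (fun j _ => Real.rpow_nonneg (groupSum_nonneg grp a μ q j) (μ j)) hs ht hst)
  have hp := groupSum_nonneg grp a μ p j
  have hq := groupSum_nonneg grp a μ q j
  calc groupSum grp a μ (s • p + t • q) j ^ μ j
      ≤ (groupSum grp a μ p j ^ s * groupSum grp a μ q j ^ t) ^ μ j :=
        Real.rpow_le_rpow (groupSum_nonneg _ _ _ _ _)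
          (groupSum_combo_le grp a μ p q j hs ht hst) (hμ0 j).le
    _ = (groupSum grp a μ p j ^ μ j) ^ s * (groupSum grp a μ q j ^ μ j) ^ t := by
        rw [Real.mul_rpow (Real.rpow_nonneg hp s) (Real.rpow_nonneg hq t),
          ← Real.rpow_mul hp, ← Real.rpow_mul hq, ← Real.rpow_mul hp, ← Real.rpow_mul hq,
          mul_comm s, mul_comm t]

/-- The expected consumer surplus `E` is a convex function of the price vector `p` on `ℝ^n`. -/
theorem surplus_convex
    {n m : ℕ} (grp : Fin n → Fin m) (hgrp : Function.Surjective grp)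
    (a : Fin n → ℝ) (μ : Fin m → ℝ) (hμ0 : ∀ j, 0 < μ j) (hμ1 : ∀ j, μ j ≤ 1) :
    ConvexOn ℝ Set.univ (surplus grp a μ) := by
  rcases isEmpty_or_nonempty (Fin m) with hm | hm
  · have hzero : surplus grp a μ = fun _ => 0 := by
      funext p
      simp [surplus, partitionFun]
    exact hzero ▸ convexOn_const 0 convex_univ
  · refine convexOn_iff_forall_pos.2 ⟨convex_univ, fun p _ q _ s t hs ht hst => ?_⟩
    have hp := partitionFun_pos hgrp a μ p
    have hq := partitionFun_pos hgrp a μ q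
    calc surplus grp a μ (s • p + t • q)
        ≤ Real.log (partitionFun grp a μ p ^ s * partitionFun grp a μ q ^ t) :=
          Real.log_le_log (partitionFun_pos hgrp a μ _)
            (partitionFun_combo_le grp a μ hμ0 p q hs ht hst)
      _ = s • surplus grp a μ p + t • surplus grp a μ q := by
          rw [Real.log_mul (Real.rpow_pos_of_pos hp s).ne' (Real.rpow_pos_of_pos hq t).ne',
            Real.log_rpow hp, Real.log_rpow hq]
          rfl
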